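/- Let Y and E be normed spaces, X a convex subset of Y, L : D(L) → F(X;E) a linear operator dominated by a positive linear operator S : D(S) → F(X;ℝ), where UCB(X;E) ⊆ D(L), UCB(X;ℝ) ⊆ D(S) and ψ_t² ∈ D(S) for every t ∈ Y. Then for every F ∈ UCB(X;E), every t ∈ X and every δ > 0 one has ‖L(F)(t) − F(t)‖ ≤ ‖L(F(t))(t) − F(t)‖ + S(‖F − F(t)‖)(t) ≤ ‖L(F(t))(t) − F(t)‖ + ω(F,δ)·[S(𝟙)(t) + δ⁻²·S(ψ_t²)(t)], where F(t) inside L denotes the constant mapping u ↦ F(t). -/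

import Mathlib

open Filter Topology Bornology

/-- The modulus of continuity of `F` on `X`:
`ω(F,h) = sup {‖F u − F t‖ : t, u ∈ X, ‖t − u‖ ≤ h}`. -/
noncomputable def modulusOfContinuity {Y E : Type*} [NormedAddCommGroup Y]
    [NormedAddCommGroup E] (X : Set Y) (F : Y → E) (h : ℝ) : ℝ :=
  sSup {r : ℝ | ∃ t ∈ X, ∃ u ∈ X, ‖t - u‖ ≤ h ∧ r = ‖F u - F t‖}

section Modulus

variable {Y E : Type*} [NormedAddCommGroup Y] [NormedAddCommGroup E] {X : Set Y} {F : Y → E}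

theorem norm_sub_le_modulusOfContinuity (hF : IsBounded (F '' X)) {h : ℝ} {t u : Y}
    (ht : t ∈ X) (hu : u ∈ X) (htu : ‖t - u‖ ≤ h) :
    ‖F u - F t‖ ≤ modulusOfContinuity X F h := by
  refine le_csSup ?_ ⟨t, ht, u, hu, htu, rfl⟩
  obtain ⟨C, hC⟩ := Metric.isBounded_iff.1 hF
  refine ⟨C, ?_⟩
  rintro r ⟨a, ha, b, hb, -, rfl⟩
  rw [← dist_eq_norm]
  exact hC (Set.mem_image_of_mem F hb) (Set.mem_image_of_mem F ha)

theorem modulusOfContinuity_nonneg (h : ℝ) : 0 ≤ modulusOfContinuity X F h := by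
  refine Real.sSup_nonneg ?_
  rintro r ⟨_, -, _, -, -, rfl⟩
  exact norm_nonneg _

theorem norm_sub_le_nat_mul_modulusOfContinuity [NormedSpace ℝ Y] (hX : Convex ℝ X)
    (hF : IsBounded (F '' X)) {h : ℝ} {t u : Y} (ht : t ∈ X) (hu : u ∈ X) {n : ℕ} (hn : 0 < n)
    (htu : ‖u - t‖ ≤ n * h) :
    ‖F u - F t‖ ≤ n * modulusOfContinuity X F h := by
  have hn' : (0 : ℝ) < n := Nat.cast_pos.2 hn
  let p : ℕ → Y := fun i => t + ((i : ℝ) / n) • (u - t)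
  have hp : ∀ i ≤ n, p i ∈ X := fun i hi =>
    hX.add_smul_sub_mem ht hu ⟨by positivity, div_le_one_of_le₀ (Nat.cast_le.2 hi) hn'.le⟩
  have hstep : ∀ i, ‖p i - p (i + 1)‖ ≤ h := fun i => by
    have : p i - p (i + 1) = (-(1 / n : ℝ)) • (u - t) := by
      simp only [p]
      rw [add_sub_add_left_eq_sub, ← sub_smul]
      congr 1
      push_cast
      ring
    rw [this, norm_smul, norm_neg, Real.norm_of_nonneg (by positivity), one_div_mul_eq_div,
      div_le_iff₀ hn', mul_comm]
    exact htu
  have hsum := dist_le_range_sum_of_dist_le (f := fun i => F (p i))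
    (d := fun _ => modulusOfContinuity X F h) n fun {i} hi => by
      rw [dist_comm, dist_eq_norm]
      exact norm_sub_le_modulusOfContinuity hF (hp i hi.le) (hp (i + 1) hi) (hstep i)
  have h0 : p 0 = t := by simp [p]
  have h1 : p n = u := by simp [p, div_self hn'.ne']
  simpa [h0, h1, dist_comm (F t), dist_eq_norm] using hsum

theorem norm_sub_le_modulusOfContinuity_mul [NormedSpace ℝ Y] (hX : Convex ℝ X)
    (hF : IsBounded (F '' X)) {δ : ℝ} (hδ : 0 < δ) {t u : Y} (ht : t ∈ X) (hu : u ∈ X) :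
    ‖F u - F t‖ ≤ modulusOfContinuity X F δ * (1 + (δ ^ 2)⁻¹ * ‖u - t‖ ^ 2) := by
  set k := ⌊‖u - t‖ / δ⌋₊
  have hk : (k : ℝ) ≤ ‖u - t‖ / δ := Nat.floor_le (by positivity)
  have hk2 : (k : ℝ) ≤ (δ ^ 2)⁻¹ * ‖u - t‖ ^ 2 := calc
    (k : ℝ) ≤ (k : ℝ) ^ 2 := by exact_mod_cast Nat.le_self_pow two_ne_zero k
    _ ≤ (‖u - t‖ / δ) ^ 2 := by gcongr
    _ = (δ ^ 2)⁻¹ * ‖u - t‖ ^ 2 := by rw [div_pow, div_eq_inv_mul]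
  have hlt : ‖u - t‖ ≤ (k + 1 : ℕ) * δ := by
    rw [← div_le_iff₀ hδ]
    exact_mod_cast (Nat.lt_floor_add_one (‖u - t‖ / δ)).le
  refine (norm_sub_le_nat_mul_modulusOfContinuity hX hF ht hu k.succ_pos hlt).trans ?_
  rw [mul_comm]
  refine mul_le_mul_of_nonneg_left ?_ (modulusOfContinuity_nonneg δ)
  push_cast
  linarith

end Modulus

theorem stmt_0
    {Y : Type*} [NormedAddCommGroup Y] [NormedSpace ℝ Y]
    {E : Type*} [NormedAddCommGroup E] [NormedSpace ℝ E]
    (X : Set Y) (hXconv : Convex ℝ X)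
    (DL : Submodule ℝ (Y → E)) (DS : Submodule ℝ (Y → ℝ))
    (L : DL →ₗ[ℝ] (Y → E)) (S : DS →ₗ[ℝ] (Y → ℝ))
    -- S is positive
    (hSpos : ∀ f : DS, (∀ u ∈ X, 0 ≤ f.1 u) → ∀ t ∈ X, 0 ≤ S f t)
    -- L is dominated by S
    (hdom_mem : ∀ F : DL, (fun u => ‖F.1 u‖) ∈ DS)
    (hdom : ∀ F : DL, ∀ t ∈ X, ‖L F t‖ ≤ S ⟨fun u => ‖F.1 u‖, hdom_mem F⟩ t)
    -- UCB(X;E) ⊆ D(L) and UCB(X;ℝ) ⊆ D(S)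
    (hDL : ∀ F : Y → E, UniformContinuousOn F X → IsBounded (F '' X) → F ∈ DL)
    (hDS : ∀ f : Y → ℝ, UniformContinuousOn f X → IsBounded (f '' X) → f ∈ DS)
    -- ψ_t² ∈ D(S) for every t ∈ Y
    (hpsi : ∀ t : Y, (fun u => ‖u - t‖ ^ 2) ∈ DS) :
    ∀ F : Y → E, UniformContinuousOn F X → IsBounded (F '' X) →
      ∀ t ∈ X, ∀ δ : ℝ, 0 < δ →
      ∀ (hF : F ∈ DL) (hc : (fun _ : Y => F t) ∈ DL)
        (hd : (fun u => ‖F u - F t‖) ∈ DS) (h1 : (fun _ : Y => (1 : ℝ)) ∈ DS),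
      ‖L ⟨F, hF⟩ t - F t‖ ≤
          ‖L ⟨fun _ => F t, hc⟩ t - F t‖ + S ⟨fun u => ‖F u - F t‖, hd⟩ t ∧
        ‖L ⟨fun _ => F t, hc⟩ t - F t‖ + S ⟨fun u => ‖F u - F t‖, hd⟩ t ≤
          ‖L ⟨fun _ => F t, hc⟩ t - F t‖ +
            modulusOfContinuity X F δ *
              (S ⟨fun _ => 1, h1⟩ t + (δ ^ 2)⁻¹ * S ⟨fun u => ‖u - t‖ ^ 2, hpsi t⟩ t) := by
  intro F _ hFb t ht δ hδ hF hc hd h1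
  constructor
  · have hsub : L ⟨F, hF⟩ t - F t = (L ⟨fun _ => F t, hc⟩ t - F t) +
        L (⟨F, hF⟩ - ⟨fun _ => F t, hc⟩) t := by
      rw [map_sub, Pi.sub_apply]
      abel
    rw [hsub]
    exact (norm_add_le _ _).trans
      (add_le_add_right (hdom (⟨F, hF⟩ - ⟨fun _ => F t, hc⟩) t ht) _)
  · refine add_le_add_right ?_ _
    set ω := modulusOfContinuity X F δ
    have h := hSpos (ω • (⟨fun _ => 1, h1⟩ + (δ ^ 2)⁻¹ • ⟨fun u => ‖u - t‖ ^ 2, hpsi t⟩) -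
      ⟨fun u => ‖F u - F t‖, hd⟩)
      (fun u hu => sub_nonneg.2 (norm_sub_le_modulusOfContinuity_mul hXconv hFb hδ ht hu)) t ht
    simpa only [map_sub, map_smul, map_add, Pi.sub_apply, Pi.add_apply, Pi.smul_apply,
      smul_eq_mul, sub_nonneg] using h
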